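/- arXiv:2203.02457 — 4 statements merged into one kernel-verified Lean document; each statement's English description precedes it below -/
import Mathlib

section
/- Let p ≥ 4 and c ≥ 2, and let C = {1, 2c}. For every n, if (h₁, …, h_p) is an exiting partition of n into p positive parts, then there exists a partition (h'₁, …, h'_p) of n into p positive parts that is not an exiting partition and satisfies G_C(h'₁) XOR ⋯ XOR G_C(h'_p) = G_C(h₁) XOR ⋯ XOR G_C(h_p). -/
/-- The minimum excludant of a set of naturals. -/
noncomputable def mex (S : Set ℕ) : ℕ := sInf {v | v ∉ S}

/-- Fueled auxiliary for the Grundy sequence of CUT with cut-set `C`. -/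
noncomputable def cutGAux (C : Finset ℕ) : ℕ → ℕ → ℕ
  | 0, _ => 0
  | fuel + 1, n =>
      mex {v | ∃ d ∈ C, ∃ l : List ℕ, l.length = d + 1 ∧ (∀ x ∈ l, 0 < x) ∧
            l.sum = n ∧ (l.map (cutGAux C fuel)).foldr (· ^^^ ·) 0 = v}

/-- The Grundy (nim-value) sequence of the game CUT with cut-set `C`. -/
noncomputable def cutG (C : Finset ℕ) (n : ℕ) : ℕ := cutGAux C n n

/-- The nim-value of an option (a tuple of pile sizes). -/
noncomputable def nimVal (C : Finset ℕ) (l : List ℕ) : ℕ :=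
  (l.map (cutG C)).foldr (· ^^^ ·) 0

/-- `m` is an innumber with respect to `c`. -/
def Innumber (c m : ℕ) : Prop := 0 < m ∧ (m % (2*c) = 1 ∨ m % (12*c) = 4*c + 2)

/-- `m` is an outnumber with respect to `c`. -/
def Outnumber (c m : ℕ) : Prop := 0 < m ∧ (m % (2*c) = 0 ∨ m % (12*c) = 4*c + 1)

/-- A partition is entering if all its parts are innumbers. -/
def Entering (c : ℕ) (l : List ℕ) : Prop := ∀ m ∈ l, Innumber c m

/-- A partition is exiting if all its parts are outnumbers. -/
def Exiting (c : ℕ) (l : List ℕ) : Prop := ∀ m ∈ l, Outnumber c m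

/-- The values of the Grundy sequence of `{1, 2c}` over its first period, indexed from zero. -/
def residueValue (c r : ℕ) : ℕ :=
  if r < 2 * c then r % 2
  else if r < 4 * c then 2 + r % 2
  else if r = 4 * c then 1
  else if r < 6 * c then 5 - r % 2
  else if r < 8 * c then 3 - r % 2
  else if r < 10 * c then 4 + r % 2
  else 6 + r % 2

/-- Closed form of the Grundy sequence of `{1, 2c}`. -/
def cutFormula (c n : ℕ) : ℕ :=
  8 * ((n - 1) / (12 * c)) + residueValue c ((n - 1) % (12 * c))

/-- The least number of blocks of length `2c` needed to produce the value `u` with even total. -/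
def blockWeight : ℕ → ℕ
  | 1 => 2
  | 2 => 1
  | 3 => 3
  | 4 => 4
  | 5 => 2
  | 6 => 5
  | 7 => 3
  | _ => 0

theorem blockWeight_xor_le {u v : ℕ} (hu : u < 8) (hv : v < 8) :
    blockWeight (u ^^^ v) ≤ blockWeight u + blockWeight v := by
  have h : ∀ u < 8, ∀ v < 8, blockWeight (u ^^^ v) ≤ blockWeight u + blockWeight v := by decide
  exact h u hu v hv

theorem residueValue_lt (c r : ℕ) : residueValue c r < 8 := by
  unfold residueValue
  split_ifs <;> omega

theorem residueValue_eq_xor {c r : ℕ} (hr : r < 12 * c) :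
    ∃ u, residueValue c r = u ^^^ (r % 2) ∧
      (u = 0 ∧ r < 2 * c ∨ u = 2 ∧ 2 * c ≤ r ∧ r < 4 * c ∨ u = 1 ∧ r = 4 * c ∨
        u = 5 ∧ 4 * c < r ∧ r < 6 * c ∨ u = 3 ∧ 6 * c ≤ r ∧ r < 8 * c ∨
        u = 4 ∧ 8 * c ≤ r ∧ r < 10 * c ∨ u = 6 ∧ 10 * c ≤ r) := by
  unfold residueValue
  split_ifs with h₁ h₂ h₃ h₄ h₅ h₆
  · exact ⟨0, by simp, by omega⟩
  · refine ⟨2, ?_, by omega⟩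
    rcases Nat.mod_two_eq_zero_or_one r with h | h <;> simp [h]
  · refine ⟨1, ?_, by omega⟩
    have : r % 2 = 0 := by omega
    simp [this]
  · refine ⟨5, ?_, by omega⟩
    rcases Nat.mod_two_eq_zero_or_one r with h | h <;> simp [h]
  · refine ⟨3, ?_, by omega⟩
    rcases Nat.mod_two_eq_zero_or_one r with h | h <;> simp [h]
  · refine ⟨4, ?_, by omega⟩
    rcases Nat.mod_two_eq_zero_or_one r with h | h <;> simp [h]
  · refine ⟨6, ?_, by omega⟩
    rcases Nat.mod_two_eq_zero_or_one r with h | h <;> simp [h]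

theorem cutFormula_add {c r : ℕ} (k : ℕ) (hr : r < 12 * c) :
    cutFormula c (12 * (c * k) + r + 1) = 8 * k + residueValue c r := by
  have h : 12 * (c * k) + r + 1 - 1 = r + 12 * c * k := by rw [Nat.add_sub_cancel]; ring
  have hc : 0 < 12 * c := by omega
  rw [cutFormula, h, Nat.add_mul_div_left _ _ hc, Nat.add_mul_mod_self_left,
    Nat.div_eq_of_lt hr, Nat.mod_eq_of_lt hr, zero_add]

theorem exists_eq_period_add {c n : ℕ} (hc : 2 ≤ c) (hn : 0 < n) :
    ∃ k r, r < 12 * c ∧ n = 12 * (c * k) + r + 1 := by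
  refine ⟨(n - 1) / (12 * c), (n - 1) % (12 * c), Nat.mod_lt _ (by omega), ?_⟩
  have h := Nat.div_add_mod (n - 1) (12 * c)
  rw [mul_assoc] at h
  omega

theorem xor_eight_mul_add {t u : ℕ} (a b : ℕ) (ht : t < 8) (hu : u < 8) :
    (8 * a + t) ^^^ (8 * b + u) = 8 * (a ^^^ b) + (t ^^^ u) := by
  have hd := Nat.xor_div_two_pow (a := 8 * a + t) (b := 8 * b + u) (n := 3)
  have hm := Nat.xor_mod_two_pow (a := 8 * a + t) (b := 8 * b + u) (n := 3)
  have h₁ : (8 * a + t) / 2 ^ 3 = a := by omega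
  have h₂ : (8 * b + u) / 2 ^ 3 = b := by omega
  have h₃ : (8 * a + t) % 2 ^ 3 = t := by omega
  have h₄ : (8 * b + u) % 2 ^ 3 = u := by omega
  rw [h₁, h₂] at hd
  rw [h₃, h₄] at hm
  omega

theorem xor_le_add_nat (a b : ℕ) : a ^^^ b ≤ a + b := by
  induction a using Nat.strong_induction_on generalizing b with
  | _ a ih =>
    rcases Nat.eq_zero_or_pos a with rfl | ha
    · simp
    · have h := ih (a / 2) (by omega) (b / 2)
      have hd := Nat.xor_div_two_pow (a := a) (b := b) (n := 1)
      have hm := Nat.xor_mod_two_pow (a := a) (b := b) (n := 1)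
      simp only [pow_one] at hd hm
      have hbit : (a % 2) ^^^ (b % 2) ≤ a % 2 + b % 2 := by
        rcases Nat.mod_two_eq_zero_or_one a with h₁ | h₁ <;>
          rcases Nat.mod_two_eq_zero_or_one b with h₂ | h₂ <;> simp [h₁, h₂]
      omega

theorem xor_mod_two_add {R r : ℕ} (u v : ℕ) :
    (u ^^^ (r % 2)) ^^^ (v ^^^ (R % 2)) = (u ^^^ v) ^^^ ((r + R) % 2) := by
  have h : (r + R) % 2 = (r % 2) ^^^ (R % 2) := by
    rcases Nat.mod_two_eq_zero_or_one r with h₁ | h₁ <;>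
      rcases Nat.mod_two_eq_zero_or_one R with h₂ | h₂ <;>
      simp [h₁, h₂, Nat.add_mod]
  rw [h]
  ac_rfl

theorem xor_lt_eight {u v : ℕ} (hu : u < 8) (hv : v < 8) : u ^^^ v < 8 :=
  Nat.xor_lt_two_pow (n := 3) hu hv

theorem xor_mod_two_lt_eight {u : ℕ} (R : ℕ) (hu : u < 8) : u ^^^ (R % 2) < 8 :=
  xor_lt_eight hu (by omega)

/-- The weight bound on the nim-sum of the closed form over a list, strict for exiting lists
unless the value is at most one. -/
theorem exists_blockWeight_bound {c : ℕ} (hc : 2 ≤ c) (l : List ℕ) (hl : ∀ x ∈ l, 0 < x) :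
    ∃ K k R u, K ≤ k ∧ u < 8 ∧ l.sum = l.length + 12 * (c * k) + R ∧
      (l.map (cutFormula c)).foldr (· ^^^ ·) 0 = 8 * K + (u ^^^ (R % 2)) ∧
      2 * c * blockWeight u ≤ R ∧ (Exiting c l → u ≤ 1 ∨ 2 * c * blockWeight u < R) := by
  induction l with
  | nil => exact ⟨0, 0, 0, 0, by simp [blockWeight]⟩
  | cons n l ih =>
    obtain ⟨K, k, R, v, hK, hv, hsum, hval, hwt, hexit⟩ :=
      ih fun x hx => hl x (List.mem_cons_of_mem n hx)
    obtain ⟨j, r, hr, rfl⟩ := exists_eq_period_add hc (hl n List.mem_cons_self)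
    obtain ⟨u, hu, hcase⟩ := residueValue_eq_xor hr
    have hu8 : u < 8 := by omega
    have hur : 2 * c * blockWeight u ≤ r := by
      rcases hcase with h | h | h | h | h | h | h <;> obtain ⟨rfl, h⟩ := h <;>
        simp only [blockWeight] <;> omega
    have hadd : 2 * c * blockWeight (u ^^^ v) ≤
        2 * c * blockWeight u + 2 * c * blockWeight v := by
      rw [← mul_add]
      exact Nat.mul_le_mul_left _ (blockWeight_xor_le hu8 hv)
    refine ⟨j ^^^ K, j + k, r + R, u ^^^ v, ?_, xor_lt_eight hu8 hv, ?_, ?_, by omega, ?_⟩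
    · exact (xor_le_add_nat j K).trans (by omega)
    · simp only [List.sum_cons, List.length_cons, hsum]
      ring
    · rw [List.map_cons, List.foldr_cons, hval, cutFormula_add j hr, hu,
        xor_eight_mul_add _ _ (xor_mod_two_lt_eight _ hu8) (xor_mod_two_lt_eight _ hv),
        xor_mod_two_add]
    · intro hE
      have hhead : u ≤ 1 ∨ 2 * c * blockWeight u < r := by
        by_contra! hcon
        have hreq : r = 2 * c * blockWeight u := le_antisymm hcon.2 hur
        rcases (hE _ List.mem_cons_self).2 with h | h
        · have e : 12 * (c * j) + r + 1 = 1 + 2 * c * (6 * j + blockWeight u) := by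
            rw [hreq]; ring
          rw [e, Nat.add_mul_mod_self_left, Nat.mod_eq_of_lt (by omega)] at h
          omega
        · have e : 12 * (c * j) + r + 1 = r + 1 + 12 * c * j := by ring
          rw [e, Nat.add_mul_mod_self_left] at h
          rcases Nat.lt_or_ge (r + 1) (12 * c) with h' | h'
          · rw [Nat.mod_eq_of_lt h'] at h
            omega
          · rw [show r + 1 = 12 * c by omega, Nat.mod_self] at h
            omega
      have htail := hexit fun m hm => hE m (List.mem_cons_of_mem _ hm)
      by_cases hle : u ≤ 1 ∧ v ≤ 1
      · left
        have := Nat.xor_lt_two_pow (n := 1) (x := u) (y := v) (by omega) (by omega)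
        omega
      · right
        omega

theorem cutFormula_one {c : ℕ} (hc : 2 ≤ c) : cutFormula c 1 = 0 := by
  have h := cutFormula_add (c := c) (r := 0) 0 (by omega)
  simpa [residueValue, show 0 < c by omega] using h

theorem cutFormula_two {c : ℕ} (hc : 2 ≤ c) : cutFormula c 2 = 1 := by
  have h := cutFormula_add (c := c) (r := 1) 0 (by omega)
  simpa [residueValue, show 1 < 2 * c by omega] using h

theorem cutFormula_two_mul_add_one {c : ℕ} (hc : 2 ≤ c) : cutFormula c (2 * c + 1) = 2 := by
  have h := cutFormula_add (c := c) (r := 2 * c) 0 (by omega)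
  simpa [residueValue, show 2 * c < 4 * c by omega] using h

/-- Two parts, at most one of them long, realize every value admitted by the weight bound. -/
theorem exists_two_parts {c : ℕ} (hc : 2 ≤ c) (R u : ℕ) (hu : u < 8)
    (hR : 2 * c * blockWeight u ≤ R) (hR' : u = 5 ∨ u = 7 → 2 * c * blockWeight u < R) :
    ∃ a b y, a + b + 2 * y = R ∧ a < 12 * c ∧ (b = 0 ∨ b = 1 ∨ b = 2 * c) ∧
      residueValue c a ^^^ cutFormula c (b + 1) = u ^^^ (R % 2) := by
  have h₁ := cutFormula_one hc
  have h₂ := cutFormula_two hc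
  have h₃ := cutFormula_two_mul_add_one hc
  have key : ∀ a b v w,
      a + b ≤ R ∧ (a + b) % 2 = R % 2 ∧ a < 12 * c ∧ (b = 0 ∨ b = 1 ∨ b = 2 * c) →
      cutFormula c (b + 1) = w → v ^^^ w = u ^^^ (R % 2) → residueValue c a = v →
      ∃ a b y, a + b + 2 * y = R ∧ a < 12 * c ∧ (b = 0 ∨ b = 1 ∨ b = 2 * c) ∧
        residueValue c a ^^^ cutFormula c (b + 1) = u ^^^ (R % 2) := by
    rintro a b v w ⟨hle, hpar, ha, hb⟩ rfl hv rfl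
    exact ⟨a, b, (R - a - b) / 2, by omega, ha, hb, hv⟩
  rcases Nat.mod_two_eq_zero_or_one R with h | h <;> interval_cases u <;>
    simp only [blockWeight] at hR hR'
  · refine key 0 0 0 0 (by omega) h₁ (by simp [h]) ?_
    unfold residueValue; split_ifs <;> omega
  · refine key (4 * c) 0 1 0 (by omega) h₁ (by simp [h]) ?_
    unfold residueValue; split_ifs <;> omega
  · refine key (2 * c) 0 2 0 (by omega) h₁ (by simp [h]) ?_
    unfold residueValue; split_ifs <;> omega
  · refine key (6 * c) 0 3 0 (by omega) h₁ (by simp [h]) ?_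
    unfold residueValue; split_ifs <;> omega
  · refine key (8 * c) 0 4 0 (by omega) h₁ (by simp [h]) ?_
    unfold residueValue; split_ifs <;> omega
  · have hlt := hR' (by norm_num)
    refine key (4 * c + 2) 0 5 0 (by omega) h₁ (by simp [h]) ?_
    unfold residueValue; split_ifs <;> omega
  · refine key (10 * c) 0 6 0 (by omega) h₁ (by simp [h]) ?_
    unfold residueValue; split_ifs <;> omega
  · have hlt := hR' (by norm_num)
    refine key (4 * c + 2) (2 * c) 5 2 (by omega) h₃ (by simp [h]) ?_
    unfold residueValue; split_ifs <;> omega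
  · refine key 1 0 1 0 (by omega) h₁ (by simp [h]) ?_
    unfold residueValue; split_ifs <;> omega
  · refine key (4 * c) 1 1 1 (by omega) h₂ (by simp [h]) ?_
    unfold residueValue; split_ifs <;> omega
  · refine key (2 * c + 1) 0 3 0 (by omega) h₁ (by simp [h]) ?_
    unfold residueValue; split_ifs <;> omega
  · refine key (6 * c + 1) 0 2 0 (by omega) h₁ (by simp [h]) ?_
    unfold residueValue; split_ifs <;> omega
  · refine key (8 * c + 1) 0 5 0 (by omega) h₁ (by simp [h]) ?_
    unfold residueValue; split_ifs <;> omega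
  · refine key (4 * c + 1) 0 4 0 (by omega) h₁ (by simp [h]) ?_
    unfold residueValue; split_ifs <;> omega
  · refine key (10 * c + 1) 0 7 0 (by omega) h₁ (by simp [h]) ?_
    unfold residueValue; split_ifs <;> omega
  · refine key (4 * c + 1) (2 * c) 4 2 (by omega) h₃ (by simp [h]) ?_
    unfold residueValue; split_ifs <;> omega

theorem not_outnumber_add_one {c b : ℕ} (hc : 2 ≤ c) (hb : b = 0 ∨ b = 1 ∨ b = 2 * c) :
    ¬ Outnumber c (b + 1) := by
  rintro ⟨-, h⟩
  rw [Nat.mod_eq_of_lt (b := 12 * c) (by omega)] at h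
  rcases hb with rfl | rfl | rfl
  · rw [Nat.mod_eq_of_lt (b := 2 * c) (by omega)] at h
    omega
  · rw [Nat.mod_eq_of_lt (b := 2 * c) (by omega)] at h
    omega
  · rw [Nat.add_mod_left, Nat.mod_eq_of_lt (b := 2 * c) (by omega)] at h
    omega

theorem foldr_xor_replicate_zero (m : ℕ) : (List.replicate m 0).foldr (· ^^^ ·) 0 = 0 := by
  induction m with
  | zero => rfl
  | succ m ih => simp [List.replicate_succ, ih]

theorem exists_nonexiting_list {c p : ℕ} (hc : 2 ≤ c) (hp : 4 ≤ p) (J R u : ℕ) (hu : u < 8)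
    (hR : 2 * c * blockWeight u ≤ R) (hR' : u = 5 ∨ u = 7 → 2 * c * blockWeight u < R) :
    ∃ l : List ℕ, l.length = p ∧ (∀ x ∈ l, 0 < x) ∧ l.sum = p + 12 * (c * J) + R ∧
      ¬ Exiting c l ∧ (l.map (cutFormula c)).foldr (· ^^^ ·) 0 = 8 * J + (u ^^^ (R % 2)) := by
  obtain ⟨a, b, y, hsum, ha, hb, hval⟩ := exists_two_parts hc R u hu hR hR'
  have hb8 : cutFormula c (b + 1) < 8 := by
    rcases hb with rfl | rfl | rfl
    · simp [cutFormula_one hc]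
    · simp [cutFormula_two hc]
    · simp [cutFormula_two_mul_add_one hc]
  refine ⟨(12 * (c * J) + a + 1) :: (b + 1) :: (y + 1) :: (y + 1) :: List.replicate (p - 4) 1,
    ?_, ?_, ?_, ?_, ?_⟩
  · simp only [List.length_cons, List.length_replicate]
    omega
  · intro x hx
    simp only [List.mem_cons, List.mem_replicate] at hx
    omega
  · simp only [List.sum_cons, List.sum_replicate, smul_eq_mul]
    omega
  · intro h
    exact not_outnumber_add_one hc hb (h (b + 1) (by simp))
  · have hxor := xor_eight_mul_add J 0 (residueValue_lt c a) hb8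
    simp only [mul_zero, zero_add, Nat.xor_zero] at hxor
    rw [hval] at hxor
    simp only [List.map_cons, List.foldr_cons, List.map_replicate, cutFormula_one hc,
      foldr_xor_replicate_zero, Nat.xor_zero, Nat.xor_self]
    rw [cutFormula_add J ha, hxor]

set_option maxHeartbeats 1000000 in
/-- Every value below that of a pile is reached either through the weight bound or by a split
into two piles. -/
theorem residueValue_attained {c r t : ℕ} (hc : 2 ≤ c) (hr : r < 12 * c)
    (ht : t < residueValue c r) :
    (∃ u R, u < 8 ∧ r = R + 2 * c ∧ t = u ^^^ (R % 2) ∧ 2 * c * blockWeight u ≤ R ∧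
        (u = 5 ∨ u = 7 → 2 * c * blockWeight u < R)) ∨
      ∃ a b, a + b + 1 = r ∧ residueValue c a ^^^ residueValue c b = t := by
  have ht8 : t < 8 := ht.trans (residueValue_lt c r)
  by_cases hw : 2 * c * blockWeight (t ^^^ (r % 2)) + 2 * c ≤ r ∧
      (t ^^^ (r % 2) = 5 ∨ t ^^^ (r % 2) = 7 →
        2 * c * blockWeight (t ^^^ (r % 2)) + 2 * c < r)
  · refine Or.inl ⟨t ^^^ (r % 2), r - 2 * c, xor_mod_two_lt_eight r ht8, by omega, ?_, by omega,
      by omega⟩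
    rw [show (r - 2 * c) % 2 = r % 2 by omega, Nat.xor_assoc, Nat.xor_self, Nat.xor_zero]
  right
  have hsplit : ∀ a b v w, a + b + 1 = r → v ^^^ w = t → residueValue c a = v →
      residueValue c b = w →
      ∃ a b, a + b + 1 = r ∧ residueValue c a ^^^ residueValue c b = t := by
    rintro a b v w hab hvw rfl rfl
    exact ⟨a, b, hab, hvw⟩
  obtain ⟨u, hu, hcase⟩ := residueValue_eq_xor hr
  rw [hu] at ht
  rcases hcase with h | h | h | h | h | h | h <;> obtain ⟨rfl, h⟩ := h <;>
    rcases Nat.mod_two_eq_zero_or_one r with hp | hp <;> rw [hp] at ht hw <;>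
    simp only [Nat.reduceXor, Nat.xor_zero, Nat.zero_xor] at ht <;> interval_cases t <;>
    simp only [Nat.reduceXor, Nat.xor_zero, blockWeight] at hw <;> try omega
  · refine hsplit 0 (r - 1) 0 0 (by omega) rfl ?_ ?_ <;>
      unfold residueValue <;> split_ifs <;> omega
  · refine hsplit (r - 2 * c) (2 * c - 1) 0 1 (by omega) rfl ?_ ?_ <;>
      unfold residueValue <;> split_ifs <;> omega
  · refine hsplit (r - 2 * c) (2 * c - 1) 1 1 (by omega) rfl ?_ ?_ <;>
      unfold residueValue <;> split_ifs <;> omega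
  · refine hsplit 0 (r - 1) 0 2 (by omega) rfl ?_ ?_ <;>
      unfold residueValue <;> split_ifs <;> omega
  · refine hsplit (2 * c) (r - 1 - 2 * c) 2 3 (by omega) rfl ?_ ?_ <;>
      unfold residueValue <;> split_ifs <;> omega
  · refine hsplit (r - 4 * c) (4 * c - 1) 0 3 (by omega) rfl ?_ ?_ <;>
      unfold residueValue <;> split_ifs <;> omega
  · refine hsplit 0 (r - 1) 0 4 (by omega) rfl ?_ ?_ <;>
      unfold residueValue <;> split_ifs <;> omega
  · refine hsplit (2 * c) (r - 1 - 2 * c) 2 2 (by omega) rfl ?_ ?_ <;>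
      unfold residueValue <;> split_ifs <;> omega
  · refine hsplit (r - 4 * c) (4 * c - 1) 1 3 (by omega) rfl ?_ ?_ <;>
      unfold residueValue <;> split_ifs <;> omega

theorem residueValue_split_ne {c r₁ r₂ : ℕ} (h : r₁ + r₂ + 1 < 12 * c) :
    residueValue c r₁ ^^^ residueValue c r₂ ≠ residueValue c (r₁ + r₂ + 1) := by
  obtain ⟨u₁, h₁, hu₁⟩ := residueValue_eq_xor (c := c) (r := r₁) (by omega)
  obtain ⟨u₂, h₂, hu₂⟩ := residueValue_eq_xor (c := c) (r := r₂) (by omega)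
  obtain ⟨u₃, h₃, hu₃⟩ := residueValue_eq_xor h
  rw [h₁, h₂, h₃, xor_mod_two_add]
  intro heq
  have hodd : u₁ ^^^ u₂ ^^^ 1 = u₃ := by
    rcases Nat.mod_two_eq_zero_or_one (r₁ + r₂) with hp | hp
    · rw [hp, show (r₁ + r₂ + 1) % 2 = 1 by omega, Nat.xor_zero] at heq
      rw [heq, Nat.xor_assoc, Nat.xor_self, Nat.xor_zero]
    · rw [hp, show (r₁ + r₂ + 1) % 2 = 0 by omega, Nat.xor_zero] at heq
      exact heq
  rcases hu₁ with hu₁ | hu₁ | hu₁ | hu₁ | hu₁ | hu₁ | hu₁ <;> obtain ⟨rfl, hu₁⟩ := hu₁ <;>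
    rcases hu₂ with hu₂ | hu₂ | hu₂ | hu₂ | hu₂ | hu₂ | hu₂ <;> obtain ⟨rfl, hu₂⟩ := hu₂ <;>
    simp only [Nat.reduceXor, Nat.xor_zero, Nat.zero_xor] at hodd <;> omega

theorem mex_eq {S : Set ℕ} {v : ℕ} (hv : v ∉ S) (hlt : ∀ w < v, w ∈ S) : mex S = v := by
  refine le_antisymm (Nat.sInf_le hv) ?_
  by_contra! h
  exact Nat.sInf_mem (s := {v | v ∉ S}) ⟨v, hv⟩ (hlt _ h)

theorem lt_sum_of_mem {l : List ℕ} (hl : ∀ x ∈ l, 0 < x) (hlen : 2 ≤ l.length) {x : ℕ}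
    (hx : x ∈ l) : x < l.sum := by
  have h := List.length_le_sum_of_one_le (l.erase x) fun i hi => hl i (List.mem_of_mem_erase hi)
  have hs := List.sum_erase hx
  have hlen' := List.length_erase_of_mem hx
  omega

theorem cutFormula_list_ne {c : ℕ} (hc : 2 ≤ c) (l : List ℕ) (hl : ∀ x ∈ l, 0 < x)
    (hlen : l.length = 2 * c + 1) :
    (l.map (cutFormula c)).foldr (· ^^^ ·) 0 ≠ cutFormula c l.sum := by
  obtain ⟨K, k, R, u, hK, hu, hsum, hval, hwt, -⟩ := exists_blockWeight_bound hc l hl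
  obtain ⟨j, r, hr, hjr⟩ := exists_eq_period_add (n := l.sum) hc (by omega)
  obtain ⟨u', hu', hcase⟩ := residueValue_eq_xor hr
  rw [hjr, cutFormula_add j hr, hval]
  intro heq
  have hb := xor_mod_two_lt_eight R hu
  have hb' := residueValue_lt c r
  obtain rfl : K = j := by omega
  obtain rfl : K = k := by
    by_contra hne
    have : c * (K + 1) ≤ c * k := Nat.mul_le_mul_left c (by omega)
    rw [mul_add] at this
    omega
  have hrR : r = R + 2 * c := by omega
  rw [hu', show r % 2 = R % 2 by omega] at heq
  obtain rfl : u = u' := Nat.xor_left_injective (x := R % 2) (by simpa using heq)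
  rcases hcase with h | h | h | h | h | h | h <;> obtain ⟨rfl, h⟩ := h <;>
    simp only [blockWeight] at hwt <;> omega

theorem cutFormula_pair_ne {c a b : ℕ} (hc : 2 ≤ c) (ha : 0 < a) (hb : 0 < b) :
    cutFormula c a ^^^ cutFormula c b ≠ cutFormula c (a + b) := by
  obtain ⟨k₁, r₁, hr₁, rfl⟩ := exists_eq_period_add hc ha
  obtain ⟨k₂, r₂, hr₂, rfl⟩ := exists_eq_period_add hc hb
  obtain ⟨k, r, hr, hk⟩ := exists_eq_period_add
    (n := 12 * (c * k₁) + r₁ + 1 + (12 * (c * k₂) + r₂ + 1)) hc (by omega)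
  rw [hk, cutFormula_add _ hr₁, cutFormula_add _ hr₂, cutFormula_add _ hr,
    xor_eight_mul_add _ _ (residueValue_lt _ _) (residueValue_lt _ _)]
  intro heq
  have hlt := xor_lt_eight (residueValue_lt c r₁) (residueValue_lt c r₂)
  have hlt' := residueValue_lt c r
  have hle := xor_le_add_nat k₁ k₂
  have hmul : c * (k₁ + k₂) = c * k₁ + c * k₂ := mul_add _ _ _
  obtain rfl : k = k₁ + k₂ := by
    by_contra hne
    have : c * (k + 1) ≤ c * (k₁ + k₂) := Nat.mul_le_mul_left c (by omega)
    rw [mul_add] at this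
    omega
  obtain rfl : r = r₁ + r₂ + 1 := by omega
  exact residueValue_split_ne hr (by omega)

theorem cutFormula_attained {c n v : ℕ} (hc : 2 ≤ c) (hn : 0 < n) (hv : v < cutFormula c n) :
    ∃ d ∈ ({1, 2 * c} : Finset ℕ), ∃ l : List ℕ, l.length = d + 1 ∧ (∀ x ∈ l, 0 < x) ∧
      l.sum = n ∧ (l.map (cutFormula c)).foldr (· ^^^ ·) 0 = v := by
  obtain ⟨k, r, hr, rfl⟩ := exists_eq_period_add hc hn
  rw [cutFormula_add k hr] at hv
  have hr8 := residueValue_lt c r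
  have hdiv := Nat.div_add_mod v 8
  have ht8 : v % 8 < 8 := Nat.mod_lt _ (by norm_num)
  have hlong : ∀ R u, u < 8 → v % 8 = u ^^^ (R % 2) → 2 * c * blockWeight u ≤ R →
      (u = 5 ∨ u = 7 → 2 * c * blockWeight u < R) →
      12 * (c * k) + r = 2 * c + 12 * (c * (v / 8)) + R →
      ∃ d ∈ ({1, 2 * c} : Finset ℕ), ∃ l : List ℕ, l.length = d + 1 ∧ (∀ x ∈ l, 0 < x) ∧
        l.sum = 12 * (c * k) + r + 1 ∧ (l.map (cutFormula c)).foldr (· ^^^ ·) 0 = v := by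
    intro R u hu htu hwt hwt' hsum
    obtain ⟨l, hlen, hpos, hs, -, hval⟩ :=
      exists_nonexiting_list (p := 2 * c + 1) hc (by omega) (v / 8) R u hu hwt hwt'
    exact ⟨2 * c, by simp, l, hlen, hpos, by omega, by omega⟩
  rcases Nat.lt_or_ge (v / 8) k with hk | hk
  · have hmul : c * (v / 8 + 1) ≤ c * k := Nat.mul_le_mul_left c hk
    rw [mul_add] at hmul
    obtain ⟨R, hR⟩ : ∃ R, 12 * (c * k) + r = 2 * c + 12 * (c * (v / 8)) + R :=
      ⟨12 * (c * k) + r - 2 * c - 12 * (c * (v / 8)), by omega⟩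
    have hu := xor_mod_two_lt_eight R ht8
    refine hlong R (v % 8 ^^^ (R % 2)) hu (by simp) ?_ ?_ hR
    · generalize v % 8 ^^^ (R % 2) = u at hu
      interval_cases u <;> simp only [blockWeight] <;> omega
    · intro h
      rcases h with h | h <;> rw [h] <;> simp only [blockWeight] <;> omega
  · have hkv : v / 8 = k := by omega
    rcases residueValue_attained hc hr (t := v % 8) (by omega) with
      ⟨u, R, hu, hrR, htu, hwt, hwt'⟩ | ⟨a, b, hab, hval⟩
    · exact hlong R u hu htu hwt hwt' (by rw [hkv]; omega)
    · refine ⟨1, by simp, [12 * (c * k) + a + 1, 12 * (c * 0) + b + 1], rfl, ?_, ?_, ?_⟩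
      · simp
      · simp only [List.sum_cons, List.sum_nil]
        omega
      · simp only [List.map_cons, List.map_nil, List.foldr_cons, List.foldr_nil, Nat.xor_zero]
        rw [cutFormula_add k (by omega), cutFormula_add 0 (by omega),
          xor_eight_mul_add _ _ (residueValue_lt _ _) (residueValue_lt _ _), hval, Nat.xor_zero]
        omega

theorem cutGAux_eq_cutFormula {c : ℕ} (hc : 2 ≤ c) (fuel n : ℕ) (hn : 0 < n) (hle : n ≤ fuel) :
    cutGAux {1, 2 * c} fuel n = cutFormula c n := by
  induction fuel generalizing n with
  | zero => omega
  | succ fuel ih =>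
    have hmap : ∀ l : List ℕ, 2 ≤ l.length → (∀ x ∈ l, 0 < x) → l.sum = n →
        l.map (cutGAux {1, 2 * c} fuel) = l.map (cutFormula c) := by
      intro l hlen hpos hsum
      refine List.map_congr_left fun x hx => ih x (hpos x hx) ?_
      have := lt_sum_of_mem hpos hlen hx
      omega
    rw [cutGAux]
    apply mex_eq
    · rintro ⟨d, hd, l, hlen, hpos, hsum, hval⟩
      have hd' : d = 1 ∨ d = 2 * c := by simpa using hd
      rw [hmap l (by omega) hpos hsum] at hval
      rcases hd' with rfl | rfl
      · obtain ⟨a, b, rfl⟩ := List.length_eq_two.mp hlen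
        subst hsum
        have h := cutFormula_pair_ne hc (hpos a (by simp)) (hpos b (by simp))
        simp at hval
        exact h hval
      · subst hsum
        exact cutFormula_list_ne hc l hpos hlen hval
    · intro v hv
      obtain ⟨d, hd, l, hlen, hpos, hsum, hval⟩ := cutFormula_attained hc hn hv
      have hd' : d = 1 ∨ d = 2 * c := by simpa using hd
      refine ⟨d, hd, l, hlen, hpos, hsum, ?_⟩
      rw [hmap l (by omega) hpos hsum, hval]

theorem nimVal_eq_cutFormula {c : ℕ} (hc : 2 ≤ c) (l : List ℕ) (hl : ∀ x ∈ l, 0 < x) :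
    nimVal {1, 2 * c} l = (l.map (cutFormula c)).foldr (· ^^^ ·) 0 := by
  have h : l.map (cutG {1, 2 * c}) = l.map (cutFormula c) :=
    List.map_congr_left fun x hx => cutGAux_eq_cutFormula hc x x (hl x hx) le_rfl
  rw [nimVal, h]

/-- For `p ≥ 4`, every exiting partition has the same nim-value as some
non-exiting partition of the same number into the same number of parts. -/
theorem exiting_has_nonexiting_twin (p : ℕ) (hp : 4 ≤ p) (c : ℕ) (hc : 2 ≤ c)
    (n : ℕ) (l : List ℕ) (hlen : l.length = p) (hpos : ∀ x ∈ l, 0 < x)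
    (hsum : l.sum = n) (hex : Exiting c l) :
    ∃ l' : List ℕ, l'.length = p ∧ (∀ x ∈ l', 0 < x) ∧ l'.sum = n ∧
      ¬ Exiting c l' ∧ nimVal {1, 2*c} l' = nimVal {1, 2*c} l := by
  obtain ⟨K, k, R, u, hK, hu, hs, hval, hwt, hstrict⟩ := exists_blockWeight_bound hc l hpos
  have hmul : c * K ≤ c * k := Nat.mul_le_mul_left c hK
  obtain ⟨l', hlen', hpos', hsum', hex', hval'⟩ :=
    exists_nonexiting_list hc hp K (R + 12 * (c * k) - 12 * (c * K)) u hu (by omega) (by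
      intro h
      have := hstrict hex
      omega)
  refine ⟨l', hlen', hpos', by omega, hex', ?_⟩
  rw [nimVal_eq_cutFormula hc l' hpos', nimVal_eq_cutFormula hc l hpos, hval, hval',
    show (R + 12 * (c * k) - 12 * (c * K)) % 2 = R % 2 by omega]
end

section
/- Fix an integer c ≥ 3. The map φ₁ restricts to a bijection from the set of innumbers with respect to c (positive integers m with m ≡ 1 (mod 2c) or m ≡ 4c+2 (mod 12c)) onto the set of innumbers with respect to 3 (positive integers m with m ≡ 1 (mod 6) or m ≡ 14 (mod 36)), and likewise restricts to a bijection from the set of outnumbers with respect to c (positive integers m with m ≡ 0 (mod 2c) or m ≡ 4c+1 (mod 12c)) onto the set of outnumbers with respect to 3 (positive integers m with m ≡ 0 (mod 6) or m ≡ 13 (mod 36)). -/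
/-- The map `r ↦ r'` on `1 ≤ r ≤ 2c`. -/
def rPrime (c r : ℕ) : ℕ :=
  if r = 1 then 1
  else if r = 2 then 2
  else if r = 2*c - 1 then 5
  else if r = 2*c then 6
  else if r % 2 = 1 then 3
  else 4

/-- The correspondence `φ_p`: writing `n = 2cq + r + p − 1` with `1 ≤ r ≤ 2c`,
`φ_p(n) = 6q + r' + p − 1`. -/
def phi (c p n : ℕ) : ℕ :=
  6 * ((n - p) / (2*c)) + rPrime c ((n - p) % (2*c) + 1) + p - 1

theorem innumber_iff {c : ℕ} (hc : 1 ≤ c) (m : ℕ) :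
    Innumber c m ↔ (∃ q, m = 2*c*q + 1) ∨ ∃ k, m = 2*c*(6*k + 2) + 2 := by
  constructor
  · rintro ⟨-, h | h⟩
    · exact .inl ⟨m / (2*c), by rw [← h, Nat.div_add_mod]⟩
    · refine .inr ⟨m / (12*c), ?_⟩
      have := Nat.div_add_mod m (12*c)
      rw [h] at this
      linarith
  · rintro (⟨q, rfl⟩ | ⟨k, rfl⟩)
    · refine ⟨by omega, .inl ?_⟩
      rw [Nat.mul_add_mod, Nat.mod_eq_of_lt (by omega)]
    · refine ⟨by omega, .inr ?_⟩
      rw [show 2*c*(6*k + 2) + 2 = 12*c*k + (4*c + 2) by ring, Nat.mul_add_mod,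
        Nat.mod_eq_of_lt (by omega)]

theorem outnumber_iff {c : ℕ} (hc : 1 ≤ c) (m : ℕ) :
    Outnumber c m ↔ (∃ q, m = 2*c*q + 2*c) ∨ ∃ k, m = 2*c*(6*k + 2) + 1 := by
  constructor
  · rintro ⟨hm, h | h⟩
    · obtain ⟨q, rfl⟩ := Nat.dvd_of_mod_eq_zero h
      obtain _ | q := q
      · simp at hm
      · exact .inl ⟨q, by ring⟩
    · refine .inr ⟨m / (12*c), ?_⟩
      have := Nat.div_add_mod m (12*c)
      rw [h] at this
      linarith
  · rintro (⟨q, rfl⟩ | ⟨k, rfl⟩)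
    · refine ⟨by omega, .inl ?_⟩
      rw [Nat.mul_add_mod, Nat.mod_self]
    · refine ⟨by omega, .inr ?_⟩
      rw [show 2*c*(6*k + 2) + 1 = 12*c*k + (4*c + 1) by ring, Nat.mul_add_mod,
        Nat.mod_eq_of_lt (by omega)]

theorem phi_one_mul_add {c r : ℕ} (q : ℕ) (hr : 1 ≤ r) (hrc : r ≤ 2*c) :
    phi c 1 (2*c*q + r) = 6*q + rPrime c r := by
  have hsub : 2*c*q + r - 1 = 2*c*q + (r - 1) := by omega
  rw [phi, hsub, Nat.mul_add_div (by omega), Nat.mul_add_mod,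
    Nat.div_eq_of_lt (by omega), Nat.mod_eq_of_lt (by omega), Nat.sub_add_cancel hr]
  omega

theorem phi_one_mul_add_one {c : ℕ} (hc : 1 ≤ c) (q : ℕ) :
    phi c 1 (2*c*q + 1) = 6*q + 1 := by
  rw [phi_one_mul_add q le_rfl (by omega)]
  simp [rPrime]

theorem phi_one_mul_add_two {c : ℕ} (hc : 1 ≤ c) (q : ℕ) :
    phi c 1 (2*c*q + 2) = 6*q + 2 := by
  rw [phi_one_mul_add q (by omega) (by omega)]
  simp [rPrime]

theorem phi_one_mul_add_two_mul {c : ℕ} (hc : 2 ≤ c) (q : ℕ) :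
    phi c 1 (2*c*q + 2*c) = 6*q + 6 := by
  rw [phi_one_mul_add q (by omega) le_rfl, rPrime, if_neg (by omega), if_neg (by omega),
    if_neg (by omega), if_pos rfl]

/-- `φ₁` restricts to a bijection from the innumbers with respect to `c` onto the
innumbers with respect to `3`, and likewise for outnumbers. -/
theorem phi_one_bijOn (c : ℕ) (hc : 3 ≤ c) :
    Set.BijOn (phi c 1) {m | Innumber c m} {m | Innumber 3 m} ∧
    Set.BijOn (phi c 1) {m | Outnumber c m} {m | Outnumber 3 m} := by
  have hc₁ : 1 ≤ c := by omega
  have h₁ := phi_one_mul_add_one hc₁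
  have h₂ := phi_one_mul_add_two hc₁
  have h₃ := phi_one_mul_add_two_mul (c := c) (by omega)
  simp only [innumber_iff hc₁, outnumber_iff hc₁, innumber_iff (c := 3) (by omega),
    outnumber_iff (c := 3) (by omega)]
  refine ⟨⟨?_, ?_, ?_⟩, ⟨?_, ?_, ?_⟩⟩
  · rintro _ (⟨q, rfl⟩ | ⟨k, rfl⟩)
    · exact .inl ⟨q, h₁ q⟩
    · exact .inr ⟨k, h₂ _⟩
  · rintro _ (⟨q, rfl⟩ | ⟨k, rfl⟩) _ (⟨q', rfl⟩ | ⟨k', rfl⟩) h <;>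
      simp only [h₁, h₂] at h
    · rw [show q = q' by omega]
    · omega
    · omega
    · rw [show k = k' by omega]
  · rintro _ (⟨q, rfl⟩ | ⟨k, rfl⟩)
    · exact ⟨_, .inl ⟨q, rfl⟩, h₁ q⟩
    · exact ⟨_, .inr ⟨k, rfl⟩, h₂ _⟩
  · rintro _ (⟨q, rfl⟩ | ⟨k, rfl⟩)
    · exact .inl ⟨q, h₃ q⟩
    · exact .inr ⟨k, h₁ _⟩
  · rintro _ (⟨q, rfl⟩ | ⟨k, rfl⟩) _ (⟨q', rfl⟩ | ⟨k', rfl⟩) h <;>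
      simp only [h₁, h₃] at h
    · rw [show q = q' by omega]
    · omega
    · omega
    · rw [show k = k' by omega]
  · rintro _ (⟨q, rfl⟩ | ⟨k, rfl⟩)
    · exact ⟨_, .inl ⟨q, rfl⟩, h₃ q⟩
    · exact ⟨_, .inr ⟨k, rfl⟩, h₁ _⟩
end

section
/- Fix an integer c ≥ 3 and let 2 ≤ p ≤ 4. Suppose h₁, …, h_p are positive integers that are either all innumbers with respect to c or all outnumbers with respect to c. If it is not the case that p = 4 and h₁ ≡ h₂ ≡ h₃ ≡ h₄ ≡ 2 (mod 2c), then φ₁(h₁) + φ₁(h₂) + ⋯ + φ₁(h_p) = φ_p(h₁ + h₂ + ⋯ + h_p). -/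
theorem phi_of_eq {c p n q s : ℕ} (hs : s < 2 * c) (hn : n = 2 * c * q + s + p) :
    phi c p n = 6 * q + rPrime c (s + 1) + p - 1 := by
  have hsub : n - p = s + 2 * c * q := by omega
  have hc : 0 < 2 * c := by omega
  rw [phi, hsub, Nat.add_mul_div_left _ _ hc, Nat.add_mul_mod_self_left,
    Nat.div_eq_of_lt hs, Nat.mod_eq_of_lt hs, Nat.zero_add]

theorem rPrime_add_one {c k : ℕ} (hc : 3 ≤ c) (hk : k ≤ 3) : rPrime c (k + 1) = k + 1 := by
  unfold rPrime
  split_ifs <;> omega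

theorem rPrime_two_mul_sub {c j : ℕ} (hc : 3 ≤ c) (hj : j ≤ 3) :
    rPrime c (2 * c - j) = 6 - j := by
  unfold rPrime
  split_ifs <;> omega

theorem Innumber.exists_eq {c m : ℕ} (hc : 3 ≤ c) (h : Innumber c m) :
    ∃ q e, e ≤ 1 ∧ m = 2 * c * q + e + 1 ∧ phi c 1 m = 6 * q + e + 1 := by
  obtain ⟨q, e, he, hm⟩ : ∃ q e, e ≤ 1 ∧ m = 2 * c * q + e + 1 := by
    rcases h.2 with h | h
    · refine ⟨m / (2 * c), 0, by omega, ?_⟩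
      have := Nat.div_add_mod m (2 * c)
      omega
    · refine ⟨6 * (m / (12 * c)) + 2, 1, le_rfl, ?_⟩
      have := Nat.div_add_mod m (12 * c)
      rw [h] at this
      linarith
  refine ⟨q, e, he, hm, ?_⟩
  rw [phi_of_eq (by omega) hm, rPrime_add_one hc (by omega)]
  omega

theorem Outnumber.exists_eq {c m : ℕ} (hc : 3 ≤ c) (h : Outnumber c m) :
    ∃ q e, e ≤ 1 ∧ m = 2 * c * (q + 1) + e ∧ phi c 1 m = 6 * (q + 1) + e := by
  obtain ⟨hpos, h | h⟩ := h
  · have hdiv := Nat.div_add_mod m (2 * c)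
    obtain ⟨q, hq⟩ : ∃ q, m / (2 * c) = q + 1 := by
      refine Nat.exists_eq_succ_of_ne_zero fun h0 => ?_
      simp only [h0, h] at hdiv
      omega
    rw [hq, h] at hdiv
    refine ⟨q, 0, by omega, hdiv.symm, ?_⟩
    rw [phi_of_eq (q := q) (s := 2 * c - 1) (by omega) (by rw [mul_add] at hdiv; omega),
      show 2 * c - 1 + 1 = 2 * c - 0 by omega, rPrime_two_mul_sub hc (by omega)]
    omega
  · have hdiv := Nat.div_add_mod m (12 * c)
    rw [h] at hdiv
    have hm : m = 2 * c * (6 * (m / (12 * c)) + 1 + 1) + 0 + 1 := by linarith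
    refine ⟨_, 1, le_rfl, hm, ?_⟩
    rw [phi_of_eq (by omega) hm, rPrime_add_one hc (by omega)]
    omega

theorem exists_sum_eq_of_innumber {c : ℕ} (hc : 3 ≤ c) (l : List ℕ)
    (h : ∀ m ∈ l, Innumber c m) :
    ∃ q k, k ≤ l.length ∧ l.sum = 2 * c * q + k + l.length ∧
      (l.map (phi c 1)).sum = 6 * q + k + l.length ∧
      (k = l.length → ∀ m ∈ l, m % (2 * c) = 2) := by
  induction l with
  | nil => exact ⟨0, 0, by simp⟩
  | cons a l ih =>
    obtain ⟨q, k, hk, hsum, hphi, hall⟩ := ih fun m hm => h m (List.mem_cons_of_mem _ hm)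
    obtain ⟨r, e, he, ha, hphia⟩ := (h a List.mem_cons_self).exists_eq hc
    simp only [List.length_cons, List.sum_cons, List.map_cons]
    refine ⟨q + r, k + e, by omega, by rw [mul_add]; omega, by omega, fun hke m hm => ?_⟩
    rcases List.mem_cons.mp hm with rfl | hm
    · obtain rfl : e = 1 := by omega
      rw [ha, add_assoc, Nat.mul_add_mod, Nat.mod_eq_of_lt (by omega)]
    · exact hall (by omega) m hm

theorem exists_sum_eq_of_outnumber {c : ℕ} (hc : 3 ≤ c) (l : List ℕ)
    (h : ∀ m ∈ l, Outnumber c m) :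
    ∃ q k, k ≤ l.length ∧ l.length ≤ q ∧ l.sum = 2 * c * q + k ∧
      (l.map (phi c 1)).sum = 6 * q + k := by
  induction l with
  | nil => exact ⟨0, 0, by simp⟩
  | cons a l ih =>
    obtain ⟨q, k, hk, hq, hsum, hphi⟩ := ih fun m hm => h m (List.mem_cons_of_mem _ hm)
    obtain ⟨r, e, he, ha, hphia⟩ := (h a List.mem_cons_self).exists_eq hc
    simp only [List.length_cons, List.sum_cons, List.map_cons]
    exact ⟨q + (r + 1), k + e, by omega, by omega, by rw [mul_add (2 * c) q]; omega, by omega⟩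

/-- For `2 ≤ p ≤ 4` and parts that are all innumbers or all outnumbers (excluding
the case of four parts all congruent to `2` mod `2c`),
`φ₁(h₁) + ⋯ + φ₁(h_p) = φ_p(h₁ + ⋯ + h_p)`. -/
theorem phi_sum (c : ℕ) (hc : 3 ≤ c) (p : ℕ) (hp2 : 2 ≤ p) (hp4 : p ≤ 4)
    (l : List ℕ) (hlen : l.length = p)
    (hinout : (∀ m ∈ l, Innumber c m) ∨ (∀ m ∈ l, Outnumber c m))
    (hexc : ¬ (p = 4 ∧ ∀ m ∈ l, m % (2*c) = 2)) :
    (l.map (phi c 1)).sum = phi c p l.sum := by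
  rcases hinout with h | h
  · obtain ⟨q, k, hk, hsum, hphi, hall⟩ := exists_sum_eq_of_innumber hc l h
    rw [hlen] at hk hsum hphi hall
    have hk3 : k ≤ 3 := by
      by_contra hk4
      exact hexc ⟨by omega, hall (by omega)⟩
    rw [hphi, phi_of_eq (by omega) hsum, rPrime_add_one hc hk3]
    omega
  · obtain ⟨q, k, hk, hq, hsum, hphi⟩ := exists_sum_eq_of_outnumber hc l h
    rw [hlen] at hk hq
    rcases hk.eq_or_lt with rfl | hlt
    · rw [hphi, phi_of_eq (q := q) (s := 0) (by omega) (by omega), rPrime_add_one hc (by omega)]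
      omega
    · obtain ⟨q, rfl⟩ : ∃ t, q = t + 1 := ⟨q - 1, by omega⟩
      rw [hphi, phi_of_eq (q := q) (s := 2 * c - (p - k)) (by omega)
          (by rw [mul_add] at hsum; omega),
        show 2 * c - (p - k) + 1 = 2 * c - (p - k - 1) by omega,
        rPrime_two_mul_sub hc (by omega)]
      omega
end

section
/- Fix an integer c ≥ 3 and let 1 ≤ p ≤ 3. Suppose O is a partition of n into p positive parts, the floor ⌊O⌋ is a partition of a, and the ceiling ⌈O⌉ is a partition of b. Then φ_p(a) ≤ φ_p(n) ≤ φ_p(b). -/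
/-- The greatest innumber less than or equal to `h`. -/
noncomputable def floorIn (c h : ℕ) : ℕ := sSup {m | Innumber c m ∧ m ≤ h}

/-- The least outnumber greater than or equal to `h`. -/
noncomputable def ceilOut (c h : ℕ) : ℕ := sInf {m | Outnumber c m ∧ h ≤ m}

/-- The floor of a partition, with the exceptional case of three parts whose
floors are all congruent to `2` modulo `2c`. -/
noncomputable def floorPart (c : ℕ) (l : List ℕ) : List ℕ :=
  match l with
  | [h1, h2, h3] =>
      if floorIn c h1 % (2*c) = 2 % (2*c) ∧ floorIn c h2 % (2*c) = 2 % (2*c) ∧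
          floorIn c h3 % (2*c) = 2 % (2*c)
      then [floorIn c h1 - 1, floorIn c h2 - 1, floorIn c h3]
      else [floorIn c h1, floorIn c h2, floorIn c h3]
  | _ => l.map (floorIn c)

/-- The ceiling of a partition. -/
noncomputable def ceilPart (c : ℕ) (l : List ℕ) : List ℕ := l.map (ceilOut c)

theorem phi_le_phi_of_le {c p x y : ℕ} (hc : 3 ≤ c) (hxy : x ≤ y)
    (h : (x - p) % (2 * c) ≤ 2 ∨ (y - p) % (2 * c) = 0 ∨ 2 * c ≤ (y - p) % (2 * c) + 3) :
    phi c p x ≤ phi c p y := by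
  have hq : (x - p) / (2 * c) ≤ (y - p) / (2 * c) := Nat.div_le_div_right (by omega)
  have hxlt : (x - p) % (2 * c) < 2 * c := Nat.mod_lt _ (by omega)
  have hylt : (y - p) % (2 * c) < 2 * c := Nat.mod_lt _ (by omega)
  have hs : (x - p) / (2 * c) = (y - p) / (2 * c) → (x - p) % (2 * c) ≤ (y - p) % (2 * c) := by
    intro he
    have h1 := Nat.div_add_mod (x - p) (2 * c)
    have h2 := Nat.div_add_mod (y - p) (2 * c)
    rw [he] at h1
    omega
  unfold phi
  generalize (x - p) / (2 * c) = q₁ at *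
  generalize (y - p) / (2 * c) = q₂ at *
  generalize (x - p) % (2 * c) = s₁ at *
  generalize (y - p) % (2 * c) = s₂ at *
  suffices 6 * q₁ + rPrime c (s₁ + 1) ≤ 6 * q₂ + rPrime c (s₂ + 1) by omega
  unfold rPrime
  rcases hq.lt_or_eq with hlt | heq
  · split_ifs <;> omega
  · have := hs heq
    split_ifs <;> omega

theorem phi_le_phi_of_eq_add {c p x y K j : ℕ} (hc : 3 ≤ c) (hxy : x ≤ y) (hj : j ≤ 2)
    (hx : x = p + 2 * c * K + j) : phi c p x ≤ phi c p y := by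
  refine phi_le_phi_of_le hc hxy (Or.inl ?_)
  rw [show x - p = 2 * c * K + j by omega, Nat.mul_add_mod, Nat.mod_eq_of_lt (by omega)]
  exact hj

theorem phi_le_phi_of_add_eq {c p x y K j : ℕ} (hc : 3 ≤ c) (hxy : x ≤ y) (hp : p ≤ y)
    (hj : j ≤ 3) (hy : y + j = p + 2 * c * K) : phi c p x ≤ phi c p y := by
  refine phi_le_phi_of_le hc hxy (Or.inr ?_)
  rcases Nat.eq_zero_or_pos j with rfl | hj0
  · left
    rw [show y - p = 2 * c * K by omega, Nat.mul_mod_right]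
  · right
    obtain _ | K := K
    · omega
    · rw [Nat.mul_succ] at hy
      rw [show y - p = 2 * c * K + (2 * c - j) by omega, Nat.mul_add_mod,
        Nat.mod_eq_of_lt (by omega)]
      omega

theorem Innumber.mod_eq {c m : ℕ} (hc : 3 ≤ c) (h : Innumber c m) :
    m % (2 * c) = 1 ∨ m % (2 * c) = 2 := by
  refine h.2.imp_right fun h' => ?_
  rw [← Nat.mod_mod_of_dvd m (show 2 * c ∣ 12 * c from ⟨6, by ring⟩), h',
    show 4 * c + 2 = 2 * c * 2 + 2 by ring, Nat.mul_add_mod, Nat.mod_eq_of_lt (by omega)]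

theorem Outnumber.mod_eq {c m : ℕ} (hc : 3 ≤ c) (h : Outnumber c m) :
    m % (2 * c) = 0 ∨ m % (2 * c) = 1 := by
  refine h.2.imp_right fun h' => ?_
  rw [← Nat.mod_mod_of_dvd m (show 2 * c ∣ 12 * c from ⟨6, by ring⟩), h',
    show 4 * c + 1 = 2 * c * 2 + 1 by ring, Nat.mul_add_mod, Nat.mod_eq_of_lt (by omega)]

theorem floorIn_spec {c h : ℕ} (hc : 3 ≤ c) (hh : 0 < h) :
    Innumber c (floorIn c h) ∧ floorIn c h ≤ h :=
  Nat.sSup_mem (s := {m | Innumber c m ∧ m ≤ h})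
    ⟨1, ⟨one_pos, Or.inl (Nat.mod_eq_of_lt (by omega))⟩, hh⟩ ⟨h, fun _ hm => hm.2⟩

theorem ceilOut_spec {c h : ℕ} (hc : 3 ≤ c) (hh : 0 < h) :
    Outnumber c (ceilOut c h) ∧ h ≤ ceilOut c h :=
  Nat.sInf_mem (s := {m | Outnumber c m ∧ h ≤ m})
    ⟨2 * c * h, ⟨by positivity, Or.inl (Nat.mul_mod_right _ _)⟩,
      Nat.le_mul_of_pos_left h (by omega)⟩

theorem exists_floorIn_eq {c h : ℕ} (hc : 3 ≤ c) (hh : 0 < h) :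
    ∃ k e, e = floorIn c h % (2 * c) ∧ (e = 1 ∨ e = 2) ∧ floorIn c h = 2 * c * k + e ∧
      floorIn c h ≤ h :=
  ⟨_, _, rfl, (floorIn_spec hc hh).1.mod_eq hc, (Nat.div_add_mod _ _).symm,
    (floorIn_spec hc hh).2⟩

theorem exists_ceilOut_add_eq {c h : ℕ} (hc : 3 ≤ c) (hh : 0 < h) :
    ∃ k e, e ≤ 1 ∧ ceilOut c h + e = 2 * c * k + 1 ∧ h ≤ ceilOut c h := by
  have hs := ceilOut_spec hc hh
  have hd := Nat.div_add_mod (ceilOut c h) (2 * c)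
  rcases hs.1.mod_eq hc with h' | h'
  · exact ⟨_, 1, le_rfl, by rw [← hd, h', add_zero], hs.2⟩
  · exact ⟨_, 0, zero_le_one, by rw [← hd, h'], hs.2⟩

/-- For `1 ≤ p ≤ 3`, if `O` is a partition of `n` with floor a partition of `a`
and ceiling a partition of `b`, then `φ_p(a) ≤ φ_p(n) ≤ φ_p(b)`. -/
theorem phi_floor_ceiling (c : ℕ) (hc : 3 ≤ c) (p : ℕ) (hp1 : 1 ≤ p) (hp3 : p ≤ 3)
    (n a b : ℕ) (O : List ℕ) (hlen : O.length = p) (hpos : ∀ x ∈ O, 0 < x)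
    (hsum : O.sum = n) (ha : (floorPart c O).sum = a) (hb : (ceilPart c O).sum = b) :
    phi c p a ≤ phi c p n ∧ phi c p n ≤ phi c p b := by
  subst hsum ha hb
  match O, hlen, hpos with
  | [], hlen, _ =>
    rw [List.length_nil] at hlen
    omega
  | [h₁], hlen, hpos =>
    obtain rfl : 1 = p := by simpa using hlen
    have hh₁ : 0 < h₁ := hpos _ (by simp)
    obtain ⟨k₁, e₁, -, he₁, hf₁, hl₁⟩ := exists_floorIn_eq hc hh₁
    obtain ⟨l₁, d₁, hd₁, hg₁, hu₁⟩ := exists_ceilOut_add_eq hc hh₁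
    simp only [floorPart, ceilPart, List.map_cons, List.map_nil, List.sum_cons, List.sum_nil]
    exact ⟨phi_le_phi_of_eq_add (K := k₁) (j := e₁ - 1) hc (by omega) (by omega) (by omega),
      phi_le_phi_of_add_eq (K := l₁) (j := d₁) hc (by omega) (by omega) (by omega) (by omega)⟩
  | [h₁, h₂], hlen, hpos =>
    obtain rfl : 2 = p := by simpa using hlen
    have hh₁ : 0 < h₁ := hpos _ (by simp)
    have hh₂ : 0 < h₂ := hpos _ (by simp)
    obtain ⟨k₁, e₁, -, he₁, hf₁, hl₁⟩ := exists_floorIn_eq hc hh₁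
    obtain ⟨k₂, e₂, -, he₂, hf₂, hl₂⟩ := exists_floorIn_eq hc hh₂
    obtain ⟨l₁, d₁, hd₁, hg₁, hu₁⟩ := exists_ceilOut_add_eq hc hh₁
    obtain ⟨l₂, d₂, hd₂, hg₂, hu₂⟩ := exists_ceilOut_add_eq hc hh₂
    simp only [floorPart, ceilPart, List.map_cons, List.map_nil, List.sum_cons, List.sum_nil]
    exact ⟨phi_le_phi_of_eq_add (K := k₁ + k₂) (j := e₁ + e₂ - 2) hc (by omega) (by omega)
        (by rw [mul_add]; omega),
      phi_le_phi_of_add_eq (K := l₁ + l₂) (j := d₁ + d₂) hc (by omega) (by omega) (by omega)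
        (by rw [mul_add]; omega)⟩
  | [h₁, h₂, h₃], hlen, hpos =>
    obtain rfl : 3 = p := by simpa using hlen
    have hh₁ : 0 < h₁ := hpos _ (by simp)
    have hh₂ : 0 < h₂ := hpos _ (by simp)
    have hh₃ : 0 < h₃ := hpos _ (by simp)
    obtain ⟨k₁, e₁, hr₁, he₁, hf₁, hl₁⟩ := exists_floorIn_eq hc hh₁
    obtain ⟨k₂, e₂, hr₂, he₂, hf₂, hl₂⟩ := exists_floorIn_eq hc hh₂
    obtain ⟨k₃, e₃, hr₃, he₃, hf₃, hl₃⟩ := exists_floorIn_eq hc hh₃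
    obtain ⟨l₁, d₁, hd₁, hg₁, hu₁⟩ := exists_ceilOut_add_eq hc hh₁
    obtain ⟨l₂, d₂, hd₂, hg₂, hu₂⟩ := exists_ceilOut_add_eq hc hh₂
    obtain ⟨l₃, d₃, hd₃, hg₃, hu₃⟩ := exists_ceilOut_add_eq hc hh₃
    constructor
    · simp only [floorPart, ← hr₁, ← hr₂, ← hr₃, Nat.mod_eq_of_lt (show 2 < 2 * c by omega)]
      split_ifs with hall <;> simp only [List.sum_cons, List.sum_nil]
      · exact phi_le_phi_of_eq_add (K := k₁ + k₂ + k₃) (j := 1) hc (by omega) (by omega)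
          (by rw [mul_add, mul_add]; omega)
      · exact phi_le_phi_of_eq_add (K := k₁ + k₂ + k₃) (j := e₁ + e₂ + e₃ - 3) hc (by omega)
          (by omega) (by rw [mul_add, mul_add]; omega)
    · simp only [ceilPart, List.map_cons, List.map_nil, List.sum_cons, List.sum_nil]
      exact phi_le_phi_of_add_eq (K := l₁ + l₂ + l₃) (j := d₁ + d₂ + d₃) hc (by omega)
        (by omega) (by omega) (by rw [mul_add, mul_add]; omega)
  | _ :: _ :: _ :: _ :: _, hlen, _ =>
    simp only [List.length_cons] at hlen
    omega
end
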